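/- Let w be a weight on ℝ and I a dyadic interval. Then there exist real numbers α_I, β_I and a measurable function h_I^w such that: (i) h_I^w is supported on I and is constant on each of the two halves I₋, I₊ of I; (ii) ∫ h_I^w · w dx = 0; (iii) ∫ (h_I^w)² w dx = 1; (iv) h_I = α_I h_I^w + β_I 1_I almost everywhere; (v) |α_I| ≤ √⟨w⟩_I; (vi) β_I = (∫_I h_I w dx)/(∫_I w dx), so that |β_I| ≤ |∫_I h_I w dx| / w(I), where w(I) := ∫_I w dx. -/

import Mathlib

open MeasureTheory Set
open scoped ENNReal Classical

noncomputable section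

/-- Length of a dyadic interval of generation `j`. -/
def dlen (j : ℤ) : ℝ := (2 : ℝ) ^ (-j)

/-- The dyadic interval `I_{j,k} = [k·2^{-j}, (k+1)·2^{-j})`. -/
def dyad (j k : ℤ) : Set ℝ := Set.Ico ((k : ℝ) * dlen j) (((k : ℝ) + 1) * dlen j)

/-- Average `⟨f⟩_I` of `f` over the dyadic interval `I = I_{j,k}`. -/
def avg (f : ℝ → ℝ) (j k : ℤ) : ℝ := (dlen j)⁻¹ * ∫ x in dyad j k, f x

/-- The Haar function `h_I` of the dyadic interval `I = I_{j,k}`. -/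
def haar (j k : ℤ) : ℝ → ℝ := fun x =>
  (Real.sqrt (dlen j))⁻¹ *
    ((dyad (j + 1) (2 * k + 1)).indicator (fun _ => (1 : ℝ)) x -
      (dyad (j + 1) (2 * k)).indicator (fun _ => (1 : ℝ)) x)

/-- `Δ_I w` for `I = I_{j,k}`. -/
def dOsc (w : ℝ → ℝ) (j k : ℤ) : ℝ :=
  |avg w (j + 1) (2 * k) - avg w j k| + |avg w (j + 1) (2 * k + 1) - avg w j k|

lemma dlen_pos' (j : ℤ) : 0 < dlen j := by unfold dlen; positivity

lemma dlen_succ' (j : ℤ) : dlen j = 2 * dlen (j + 1) := by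
  unfold dlen
  rw [show -j = 1 + -(j + 1) by ring, zpow_add₀ (by norm_num), zpow_one]

lemma dyad_split (j k : ℤ) :
    dyad j k = dyad (j + 1) (2 * k) ∪ dyad (j + 1) (2 * k + 1) := by
  have h := dlen_pos' (j + 1)
  unfold dyad
  rw [dlen_succ' j]
  push_cast
  rw [Set.Ico_union_Ico_eq_Ico (by nlinarith) (by nlinarith)]
  congr 1 <;> ring

lemma dyad_disj (j k : ℤ) : Disjoint (dyad j (2 * k)) (dyad j (2 * k + 1)) := by
  unfold dyad
  rw [Set.disjoint_left]
  rintro x ⟨_, h1⟩ ⟨h2, _⟩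
  push_cast at h1 h2
  linarith

lemma dyad_meas (j k : ℤ) : MeasurableSet (dyad j k) := measurableSet_Ico

lemma dyad_intOn (w : ℝ → ℝ) (hwloc : LocallyIntegrable w) (j k : ℤ) :
    IntegrableOn w (dyad j k) :=
  (hwloc.integrableOn_isCompact (isCompact_Icc)).mono_set Set.Ico_subset_Icc_self

lemma dyad_int_pos (w : ℝ → ℝ) (hw : ∀ x, 0 < w x) (hwloc : LocallyIntegrable w) (j k : ℤ) :
    0 < ∫ x in dyad j k, w x := by
  rw [setIntegral_pos_iff_support_of_nonneg_ae (Filter.Eventually.of_forall fun x => (hw x).le)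
    (dyad_intOn w hwloc j k)]
  have : Function.support w = Set.univ := by
    ext x; simp [(hw x).ne']
  rw [this, Set.univ_inter, dyad, Real.volume_Ico]
  have h := dlen_pos' j
  simp only [ENNReal.ofReal_pos]
  nlinarith

lemma int_two (w : ℝ → ℝ) (A B : Set ℝ) (hA : MeasurableSet A) (hB : MeasurableSet B)
    (iA : IntegrableOn w A) (iB : IntegrableOn w B) (f : ℝ → ℝ) (p q : ℝ)
    (hf : ∀ x, f x = p * A.indicator w x + q * B.indicator w x) :
    ∫ x, f x = p * (∫ x in A, w x) + q * ∫ x in B, w x := by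
  rw [funext hf, integral_add, integral_const_mul, integral_const_mul, integral_indicator hA,
    integral_indicator hB]
  · exact (iA.integrable_indicator hA).const_mul p
  · exact (iB.integrable_indicator hB).const_mul q

/-- decomposition `h_I = α_I h_I^w + β_I 1_I` of the Haar function into a
weighted Haar function and a constant, with `|α_I| ≤ √⟨w⟩_I` and
`β_I = (∫_I h_I w dx)/w(I)`. -/
theorem haar_decomposition (w : ℝ → ℝ) (hw : ∀ x, 0 < w x) (hwm : Measurable w)
    (hwloc : LocallyIntegrable w) (hσloc : LocallyIntegrable fun x => (w x)⁻¹)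
    (j k : ℤ) :
    ∃ (a b : ℝ) (h : ℝ → ℝ), Measurable h ∧
      (∀ x ∉ dyad j k, h x = 0) ∧
      (∀ x ∈ dyad (j + 1) (2 * k), ∀ y ∈ dyad (j + 1) (2 * k), h x = h y) ∧
      (∀ x ∈ dyad (j + 1) (2 * k + 1), ∀ y ∈ dyad (j + 1) (2 * k + 1), h x = h y) ∧
      (∫ x, h x * w x) = 0 ∧
      (∫ x, (h x) ^ 2 * w x) = 1 ∧
      (∀ᵐ x, haar j k x = a * h x + b * (dyad j k).indicator (fun _ => (1 : ℝ)) x) ∧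
      |a| ≤ Real.sqrt (avg w j k) ∧
      b = (∫ x in dyad j k, haar j k x * w x) / (∫ x in dyad j k, w x) ∧
      |b| ≤ |∫ x in dyad j k, haar j k x * w x| / (∫ x in dyad j k, w x) := by
  have hI := dyad_split j k
  have hd := dyad_disj (j + 1) k
  have mA := dyad_meas (j + 1) (2 * k)
  have mB := dyad_meas (j + 1) (2 * k + 1)
  have mI := dyad_meas j k
  have iA := dyad_intOn w hwloc (j + 1) (2 * k)
  have iB := dyad_intOn w hwloc (j + 1) (2 * k + 1)
  have hP := dyad_int_pos w hw hwloc (j + 1) (2 * k)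
  have hQ := dyad_int_pos w hw hwloc (j + 1) (2 * k + 1)
  have hPQ : ∫ x in dyad j k, w x = (∫ x in dyad (j + 1) (2 * k), w x) +
      ∫ x in dyad (j + 1) (2 * k + 1), w x := by
    rw [hI, setIntegral_union hd mB iA iB]
  have hl := dlen_pos' j
  have havg : avg w j k = (dlen j)⁻¹ * ∫ x in dyad j k, w x := rfl
  have hhaar : ∀ x, haar j k x = (Real.sqrt (dlen j))⁻¹ *
    ((dyad (j + 1) (2 * k + 1)).indicator (fun _ => (1 : ℝ)) x -
      (dyad (j + 1) (2 * k)).indicator (fun _ => (1 : ℝ)) x) := fun x => rfl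
  generalize haar j k = H at *
  generalize dyad (j + 1) (2 * k) = A at *
  generalize dyad (j + 1) (2 * k + 1) = B at *
  generalize dyad j k = I at *
  subst hI
  have hs : 0 < (Real.sqrt (dlen j))⁻¹ := by positivity
  have hs2 : (Real.sqrt (dlen j))⁻¹ ^ 2 = (dlen j)⁻¹ := by
    rw [inv_pow, Real.sq_sqrt hl.le]
  have hBA : ∀ x, x ∈ A → x ∉ B := fun x hx => Set.disjoint_left.1 hd hx
  have hint : ∫ x in A ∪ B, H x * w x =
      -(Real.sqrt (dlen j))⁻¹ * (∫ x in A, w x) + (Real.sqrt (dlen j))⁻¹ * ∫ x in B, w x := by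
    rw [← integral_indicator mI]
    refine int_two w A B mA mB iA iB _ _ _ fun x => ?_
    by_cases h1 : x ∈ A
    · simp [h1, hBA x h1, hhaar]
    · by_cases h2 : x ∈ B <;> simp [h1, h2, hhaar]
  rw [havg, hint, hPQ, ← hs2]
  clear havg hint hs2
  generalize (Real.sqrt (dlen j))⁻¹ = s at *
  have key := int_two w A B mA mB iA iB
  generalize (∫ x in A, w x) = P at *
  generalize (∫ x in B, w x) = Q at *
  have hc : 0 < Real.sqrt (P * Q / (P + Q)) := by positivity
  have hc2 : Real.sqrt (P * Q / (P + Q)) ^ 2 = P * Q / (P + Q) := Real.sq_sqrt (by positivity)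
  generalize Real.sqrt (P * Q / (P + Q)) = c at *
  refine ⟨2 * s * c, (-s * P + s * Q) / (P + Q),
    fun x => (-(c / P)) * A.indicator (fun _ => (1 : ℝ)) x +
      (c / Q) * B.indicator (fun _ => (1 : ℝ)) x, ?_, ?_, ?_, ?_, ?_, ?_, ?_, ?_, rfl, ?_⟩
  · exact ((measurable_const.indicator mA).const_mul _).add
      ((measurable_const.indicator mB).const_mul _)
  · intro x hx
    simp only [Set.mem_union, not_or] at hx
    simp [hx.1, hx.2]
  · intro x hx y hy
    simp [hx, hy, hBA x hx, hBA y hy]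
  · intro x hx y hy
    have h1 : x ∉ A := fun h => hBA x h hx
    have h2 : y ∉ A := fun h => hBA y h hy
    simp [hx, hy, h1, h2]
  · rw [key _ (-(c / P)) (c / Q)]
    · field_simp
      ring
    · intro x
      by_cases h1 : x ∈ A
      · simp [h1, hBA x h1]
      · by_cases h2 : x ∈ B <;> simp [h1, h2]
  · rw [key _ ((c / P) ^ 2) ((c / Q) ^ 2)]
    · rw [div_pow, div_pow, hc2]
      field_simp
      ring
    · intro x
      by_cases h1 : x ∈ A
      · simp [h1, hBA x h1]
      · by_cases h2 : x ∈ B <;> simp [h1, h2]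
  · refine Filter.Eventually.of_forall fun x => ?_
    rw [hhaar]
    by_cases h1 : x ∈ A
    · simp only [h1, hBA x h1, Set.indicator_of_mem, Set.mem_union, true_or, not_false_eq_true,
        Set.indicator_of_notMem]
      have : 2 * s * c * (-(c / P) * 1 + c / Q * 0) = - (2 * s * c ^ 2 / P) := by ring
      rw [this, hc2]
      field_simp
      ring
    · by_cases h2 : x ∈ B
      · simp only [h1, h2, Set.indicator_of_mem, Set.mem_union, or_true, not_false_eq_true,
          Set.indicator_of_notMem]
        have : 2 * s * c * (-(c / P) * 0 + c / Q * 1) = (2 * s * c ^ 2 / Q) := by ring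
        rw [this, hc2]
        field_simp
        ring
      · simp [h1, h2]
  · apply Real.abs_le_sqrt
    have : (2 * s * c) ^ 2 = s ^ 2 * (4 * c ^ 2) := by ring
    rw [this, hc2]
    refine mul_le_mul_of_nonneg_left ?_ (sq_nonneg s)
    rw [← mul_div_assoc, div_le_iff₀ (by positivity)]
    nlinarith [sq_nonneg (P - Q)]
  · rw [abs_div, abs_of_pos (show 0 < P + Q by positivity)]
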